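/- Let G be a family of pairs (a, b) of meromorphic functions on the unit disk and ε > 0. If σ(a(z), b(z)) ≥ ε for all (a, b) ∈ G and all z in the disk, then both families {a : (a, b) ∈ G} and {b : (a, b) ∈ G} are normal in the unit disk. -/

import Mathlib

open Filter Topology OnePoint Metric
open scoped Classical

noncomputable def chord : OnePoint ℂ → OnePoint ℂ → ℝ := fun x y =>
  Option.elim (α := ℂ) x
    (Option.elim (α := ℂ) y 0 (fun b => 2 / Real.sqrt (1 + ‖b‖ ^ 2)))
    (fun a =>
      Option.elim (α := ℂ) y (2 / Real.sqrt (1 + ‖a‖ ^ 2))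
        (fun b => 2 * ‖a - b‖ / Real.sqrt ((1 + ‖a‖ ^ 2) * (1 + ‖b‖ ^ 2))))

/-- spherical (arclength) metric on the Riemann sphere, diameter π -/
noncomputable def sph (x y : OnePoint ℂ) : ℝ := 2 * Real.arcsin (chord x y / 2)

/-- value of a meromorphic function as a point of the Riemann sphere -/
noncomputable def sphVal (f : ℂ → ℂ) (z : ℂ) : OnePoint ℂ :=
  if Tendsto (fun w => ‖f w‖) (𝓝[≠] z) atTop then ∞
  else (((limUnder (𝓝[≠] z) f : ℂ) : OnePoint ℂ))

def IsMeroSphere (D : Set ℂ) (A : ℂ → OnePoint ℂ) : Prop :=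
  ∃ a : ℂ → ℂ, MeromorphicOn a D ∧ ∀ z ∈ D, A z = sphVal a z

def IsMeroSphereOrInf (D : Set ℂ) (A : ℂ → OnePoint ℂ) : Prop :=
  IsMeroSphere D A ∨ ∀ z ∈ D, A z = ∞

/-- Normality: every sequence has a subsequence converging locally uniformly (spherically)
to a meromorphic function or to ∞. -/
def NormalOn (D : Set ℂ) (F : Set (ℂ → ℂ)) : Prop :=
  ∀ f : ℕ → ℂ → ℂ, (∀ n, f n ∈ F) →
    ∃ φ : ℕ → ℕ, StrictMono φ ∧ ∃ G : ℂ → OnePoint ℂ,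
      IsMeroSphereOrInf D G ∧
      ∀ K : Set ℂ, K ⊆ D → IsCompact K → ∀ ε : ℝ, 0 < ε →
        ∀ᶠ n in atTop, ∀ z ∈ K, sph (sphVal (f (φ n)) z) (G z) < ε

/-- rational map of degree at most m -/
def IsRatDegLE (m : ℕ) (R : ℂ → ℂ) : Prop :=
  ∃ p q : Polynomial ℂ, q ≠ 0 ∧ p.degree ≤ (m : ℕ) ∧ q.degree ≤ (m : ℕ) ∧
    ∀ z : ℂ, R z = p.eval z / q.eval z



theorem taylor_coeffs {f : ℂ → ℂ} {C : ℝ} (hf : DifferentiableOn ℂ f (ball 0 1))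
    (hC : ∀ z ∈ ball (0:ℂ) 1, ‖f z‖ ≤ C) :
    ∃ c : ℕ → ℂ, (∀ k, ‖c k‖ ≤ C) ∧ ∀ z ∈ ball (0:ℂ) 1, HasSum (fun k => c k * z ^ k) (f z) := by
  refine ⟨fun k => (k.factorial : ℂ)⁻¹ * iteratedDeriv k f 0, fun k => ?_, fun z hz => ?_⟩
  · have h1 : ∀ R ∈ Set.Ioo (0:ℝ) 1, ‖(k.factorial : ℂ)⁻¹ * iteratedDeriv k f 0‖ ≤ C / R ^ k := by
      intro R hR
      have := Complex.norm_iteratedDeriv_le_of_forall_mem_sphere_norm_le (c := 0) (R := R) (C := C)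
        (f := f) k hR.1 ?_ ?_
      · rw [norm_mul, norm_inv, Complex.norm_natCast]
        have hk : (0:ℝ) < k.factorial := by exact_mod_cast k.factorial_pos
        rw [inv_mul_le_iff₀ hk]
        rw [mul_div_assoc] at this
        exact this
      · apply DifferentiableOn.diffContOnCl
        rw [closure_ball _ hR.1.ne']
        exact hf.mono (closedBall_subset_ball hR.2)
      · intro z hz
        apply hC
        simp at hz ⊢
        linarith [hR.2]
    have h2 : Tendsto (fun R : ℝ => C / R ^ k) (𝓝[<] 1) (𝓝 (C / 1 ^ k)) := by
      apply Tendsto.mono_left _ nhdsWithin_le_nhds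
      apply ContinuousAt.tendsto (f := fun R : ℝ => C / R ^ k)
      fun_prop (disch := norm_num)
    have h3 : ∀ᶠ R in 𝓝[<] (1:ℝ), R ∈ Set.Ioo (0:ℝ) 1 := Ioo_mem_nhdsLT (by norm_num)
    have := ge_of_tendsto h2 (h3.mono h1)
    simpa using this
  · have := Complex.hasSum_taylorSeries_on_ball hf hz
    simp only [smul_eq_mul, sub_zero] at this
    have e : (fun k : ℕ => (k.factorial : ℂ)⁻¹ * iteratedDeriv k f 0 * z ^ k) =
        fun k : ℕ => (k.factorial : ℂ)⁻¹ * (z ^ k * iteratedDeriv k f 0) := by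
      funext k
      ring
    rw [e]
    exact this

theorem montel_disk {f : ℕ → ℂ → ℂ} {C : ℝ} (hf : ∀ n, DifferentiableOn ℂ (f n) (ball 0 1))
    (hC : ∀ n, ∀ z ∈ ball (0:ℂ) 1, ‖f n z‖ ≤ C) :
    ∃ φ : ℕ → ℕ, StrictMono φ ∧ ∃ F : ℂ → ℂ, DifferentiableOn ℂ F (ball 0 1) ∧
      (∀ z ∈ ball (0:ℂ) 1, ‖F z‖ ≤ C) ∧
      TendstoLocallyUniformlyOn (fun n => f (φ n)) F atTop (ball 0 1) := by
  choose c hc hs using fun n => taylor_coeffs (hf n) (hC n)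
  have hcomp : IsCompact (Set.pi Set.univ fun _ : ℕ => closedBall (0:ℂ) C) :=
    isCompact_univ_pi fun _ => isCompact_closedBall _ _
  obtain ⟨d, hd, φ, hφ, hlim⟩ := hcomp.tendsto_subseq (x := c) (fun n k _ => by simpa using hc n k)
  have hd' : ∀ k, ‖d k‖ ≤ C := fun k => by simpa using hd k (Set.mem_univ _)
  have hlim' : ∀ k, Tendsto (fun n => c (φ n) k) atTop (𝓝 (d k)) := fun k =>
    (tendsto_pi_nhds.1 hlim) k
  have hsum : ∀ z ∈ ball (0:ℂ) 1, Summable (fun k => d k * z ^ k) := by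
    intro z hz
    have hz' : ‖z‖ < 1 := by simpa using hz
    refine Summable.of_norm_bounded (g := fun k => C * ‖z‖ ^ k)
      ((summable_geometric_of_lt_one (norm_nonneg _) hz').mul_left _) fun k => ?_
    rw [norm_mul, norm_pow]
    gcongr
    exact hd' k
  have hconv : TendstoLocallyUniformlyOn (fun n => f (φ n)) (fun z => ∑' k, d k * z ^ k)
      atTop (ball 0 1) := by
    rw [tendstoLocallyUniformlyOn_iff_forall_isCompact isOpen_ball]
    intro K hK hKc
    obtain ⟨r, hr0, hr1, hKr⟩ : ∃ r : ℝ, 0 ≤ r ∧ r < 1 ∧ ∀ z ∈ K, ‖z‖ ≤ r := by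
      rcases K.eq_empty_or_nonempty with rfl | hne
      · exact ⟨0, le_rfl, one_pos, by simp⟩
      · obtain ⟨x, hx, hmax⟩ := hKc.exists_isMaxOn hne continuous_norm.continuousOn
        exact ⟨‖x‖, norm_nonneg _, by simpa using hK hx, fun z hz => hmax hz⟩
    have hC0 : 0 ≤ C := (norm_nonneg _).trans (hd' 0)
    have hgeo := summable_geometric_of_lt_one hr0 hr1
    have hbd : ∀ n k, ‖c (φ n) k - d k‖ * r ^ k ≤ (2 * C) * r ^ k := by
      intro n k
      gcongr
      calc _ ≤ ‖c (φ n) k‖ + ‖d k‖ := norm_sub_le _ _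
        _ ≤ 2 * C := by linarith [hc (φ n) k, hd' k]
    have hT : Tendsto (fun n => ∑' k, ‖c (φ n) k - d k‖ * r ^ k) atTop (𝓝 (∑' k : ℕ, 0)) := by
      refine tendsto_tsum_of_dominated_convergence (bound := fun k => (2 * C) * r ^ k)
        (hgeo.mul_left _) (fun k => ?_) (Eventually.of_forall fun n k => ?_)
      · have := ((hlim' k).sub_const (d k)).norm.mul_const (r ^ k)
        simpa using this
      · rw [Real.norm_of_nonneg (by positivity)]
        exact hbd n k
    rw [tsum_zero] at hT
    rw [Metric.tendstoUniformlyOn_iff]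
    intro ε hε
    filter_upwards [hT.eventually_lt_const hε] with n hn z hz
    refine lt_of_le_of_lt ?_ hn
    have e1 := (hs (φ n) z (hK hz)).sub (hsum z (hK hz)).hasSum
    rw [dist_comm, dist_eq_norm, ← e1.tsum_eq]
    refine tsum_of_norm_bounded (Summable.hasSum ?_) fun k => ?_
    · exact Summable.of_nonneg_of_le (fun k => by positivity) (hbd n) (hgeo.mul_left _)
    · rw [← sub_mul, norm_mul, norm_pow]
      gcongr
      exact hKr z hz
  refine ⟨φ, hφ, fun z => ∑' k, d k * z ^ k, ?_, ?_, hconv⟩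
  · exact hconv.differentiableOn (Eventually.of_forall fun n => hf (φ n)) isOpen_ball
  · intro z hz
    exact le_of_tendsto (hconv.tendsto_at hz).norm (Eventually.of_forall fun n => hC (φ n) z hz)

theorem remove_sing {u : ℂ → ℂ} {C : ℝ} (hu : MeromorphicOn u (ball 0 1))
    (hC : ∀ z ∈ ball (0:ℂ) 1, ∀ᶠ w in 𝓝[≠] z, ‖u w‖ ≤ C) :
    ∃ U : ℂ → ℂ, DifferentiableOn ℂ U (ball 0 1) ∧ (∀ z ∈ ball (0:ℂ) 1, ‖U z‖ ≤ C) ∧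
      ∀ z ∈ ball (0:ℂ) 1, U =ᶠ[𝓝[≠] z] u := by
  have han : ∀ z ∈ ball (0:ℂ) 1, AnalyticAt ℂ (toMeromorphicNFOn u (ball 0 1)) z := by
    intro z hz
    rw [← (meromorphicNFOn_toMeromorphicNFOn (f := u) (U := ball 0 1) hz).meromorphicOrderAt_nonneg_iff_analyticAt,
      meromorphicOrderAt_toMeromorphicNFOn hu hz]
    by_contra hneg
    rw [not_le, ← tendsto_cobounded_iff_meromorphicOrderAt_neg (hu z hz),
      ← tendsto_norm_atTop_iff_cobounded] at hneg
    obtain ⟨w, h1, h2⟩ := ((hneg.eventually_gt_atTop C).and (hC z hz)).exists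
    exact absurd h2 (not_le.2 h1)
  have heq : ∀ z ∈ ball (0:ℂ) 1, toMeromorphicNFOn u (ball 0 1) =ᶠ[𝓝[≠] z] u := fun z hz =>
    hu.toMeromorphicNFOn_eq_self_on_nhdsNE hz
  refine ⟨_, fun z hz => (han z hz).differentiableAt.differentiableWithinAt, fun z hz => ?_, heq⟩
  have ht : Tendsto (toMeromorphicNFOn u (ball 0 1)) (𝓝[≠] z)
      (𝓝 (toMeromorphicNFOn u (ball 0 1) z)) :=
    (han z hz).continuousAt.tendsto.mono_left nhdsWithin_le_nhds
  refine le_of_tendsto ht.norm ?_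
  filter_upwards [heq z hz, hC z hz] with w h1 h2
  rwa [h1]

/-- point of the sphere with homogeneous coordinates -/
noncomputable def hpt (p q : ℂ) : OnePoint ℂ := if q = 0 then ∞ else ((p / q : ℂ) : OnePoint ℂ)

theorem sphVal_of_tendsto {f : ℂ → ℂ} {z l : ℂ} (h : Tendsto f (𝓝[≠] z) (𝓝 l)) :
    sphVal f z = (l : OnePoint ℂ) := by
  have : ¬ Tendsto (fun w => ‖f w‖) (𝓝[≠] z) atTop := not_tendsto_atTop_of_tendsto_nhds h.norm
  rw [sphVal, if_neg this, h.limUnder_eq]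

theorem sphVal_eq_hpt {a p q : ℂ → ℂ} {z : ℂ} (h : ∀ᶠ w in 𝓝[≠] z, a w * q w = p w)
    (hp : ContinuousAt p z) (hq : ContinuousAt q z) (hne : p z ≠ 0 ∨ q z ≠ 0) :
    sphVal a z = hpt (p z) (q z) := by
  have hp' : Tendsto p (𝓝[≠] z) (𝓝 (p z)) := hp.tendsto.mono_left nhdsWithin_le_nhds
  have hq' : Tendsto q (𝓝[≠] z) (𝓝 (q z)) := hq.tendsto.mono_left nhdsWithin_le_nhds
  by_cases h0 : q z = 0
  · have hpz : p z ≠ 0 := by tauto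
    rw [hpt, if_pos h0, sphVal, if_pos]
    have hpne := hp'.eventually_ne hpz
    have hq0 : Tendsto (fun w => ‖q w‖) (𝓝[≠] z) (𝓝[>] 0) := by
      rw [tendsto_nhdsWithin_iff]
      refine ⟨by simpa [h0] using hq'.norm, ?_⟩
      filter_upwards [h, hpne] with w h1 h2
      simp only [Set.mem_Ioi, norm_pos_iff]
      rintro h3
      rw [h3, mul_zero] at h1
      exact h2 h1.symm
    have := (tendsto_inv_nhdsGT_zero.comp hq0).atTop_mul_pos (norm_pos_iff.2 hpz) hp'.norm
    refine this.congr' ?_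
    filter_upwards [h, hpne] with w h1 h2
    have : q w ≠ 0 := by rintro h3; rw [h3, mul_zero] at h1; exact h2 h1.symm
    rw [← h1, norm_mul]
    simp only [Function.comp]
    field_simp
  · rw [hpt, if_neg h0]
    apply sphVal_of_tendsto
    refine (hp'.div hq' h0).congr' ?_
    filter_upwards [h, hq'.eventually_ne h0] with w h1 h2
    rw [Pi.div_apply, ← h1]
    field_simp

theorem chord_hpt {p q r s : ℂ} (h1 : p ≠ 0 ∨ q ≠ 0) (h2 : r ≠ 0 ∨ s ≠ 0) :
    chord (hpt p q) (hpt r s) =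
      2 * ‖p * s - r * q‖ / (Real.sqrt (‖p‖^2 + ‖q‖^2) * Real.sqrt (‖r‖^2 + ‖s‖^2)) := by
  have key : ∀ x y : ℂ, y ≠ 0 → Real.sqrt (1 + ‖x / y‖ ^ 2) = Real.sqrt (‖x‖^2 + ‖y‖^2) / ‖y‖ := by
    intro x y hy
    have : 1 + ‖x / y‖ ^ 2 = (‖x‖^2 + ‖y‖^2) / ‖y‖ ^ 2 := by
      rw [norm_div]; field_simp; ring
    rw [this, Real.sqrt_div (by positivity), Real.sqrt_sq (norm_nonneg _)]
  have pos : ∀ x y : ℂ, (x ≠ 0 ∨ y ≠ 0) → 0 < Real.sqrt (‖x‖^2 + ‖y‖^2) := by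
    intro x y h
    apply Real.sqrt_pos.2
    rcases h with h | h <;> positivity
  have P1 := pos p q h1
  have P2 := pos r s h2
  by_cases hq : q = 0 <;> by_cases hs : s = 0
  · simp only [hpt, if_pos hq, if_pos hs]
    change (0:ℝ) = _
    simp [hq, hs]
  · simp only [hpt, if_pos hq, if_neg hs]
    change 2 / Real.sqrt (1 + ‖r / s‖ ^ 2) = _
    have hp : p ≠ 0 := by tauto
    rw [key r s hs]
    subst hq
    simp only [mul_zero, sub_zero, norm_mul, norm_zero, ne_eq, OfNat.ofNat_ne_zero,
      not_false_eq_true, zero_pow, add_zero, Real.sqrt_sq (norm_nonneg _)]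
    have := norm_pos_iff.2 hp
    field_simp
  · simp only [hpt, if_neg hq, if_pos hs]
    change 2 / Real.sqrt (1 + ‖p / q‖ ^ 2) = _
    have hr : r ≠ 0 := by tauto
    rw [key p q hq]
    subst hs
    simp only [mul_zero, zero_sub, norm_neg, norm_mul, norm_zero, ne_eq, OfNat.ofNat_ne_zero,
      not_false_eq_true, zero_pow, add_zero, Real.sqrt_sq (norm_nonneg _)]
    have := norm_pos_iff.2 hr
    field_simp
  · simp only [hpt, if_neg hq, if_neg hs]
    change 2 * ‖p / q - r / s‖ / Real.sqrt ((1 + ‖p / q‖ ^ 2) * (1 + ‖r / s‖ ^ 2)) = _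
    rw [Real.sqrt_mul (by positivity), key p q hq, key r s hs, div_sub_div _ _ hq hs, norm_div,
      norm_mul, mul_comm q r]
    have := norm_pos_iff.2 hq
    have := norm_pos_iff.2 hs
    field_simp

theorem sphVal_analytic {f : ℂ → ℂ} {z : ℂ} (h : AnalyticAt ℂ f z) :
    sphVal f z = (f z : OnePoint ℂ) :=
  sphVal_of_tendsto (h.continuousAt.tendsto.mono_left nhdsWithin_le_nhds)

theorem chord_comm' (x y : OnePoint ℂ) : chord x y = chord y x := by
  rcases x with _ | a <;> rcases y with _ | b
  · rfl
  · rfl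
  · rfl
  · change 2 * ‖a - b‖ / Real.sqrt ((1 + ‖a‖ ^ 2) * (1 + ‖b‖ ^ 2)) =
      2 * ‖b - a‖ / Real.sqrt ((1 + ‖b‖ ^ 2) * (1 + ‖a‖ ^ 2))
    rw [norm_sub_rev, mul_comm (1 + ‖a‖ ^ 2)]

theorem pair_data {a b : ℂ → ℂ} {δ : ℝ} (hδ : 0 < δ) (ha : MeromorphicOn a (ball 0 1))
    (hb : MeromorphicOn b (ball 0 1))
    (hsep : ∀ z ∈ ball (0:ℂ) 1, δ ≤ chord (sphVal a z) (sphVal b z) / 2) :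
    ∃ U V W : ℂ → ℂ,
      (DifferentiableOn ℂ U (ball 0 1) ∧ DifferentiableOn ℂ V (ball 0 1) ∧
        DifferentiableOn ℂ W (ball 0 1)) ∧
      (∀ z ∈ ball (0:ℂ) 1, ‖U z‖ ≤ 1 / δ ∧ ‖V z‖ ≤ 1 / δ ∧ ‖W z‖ ≤ 1 / δ) ∧
      (∀ z ∈ ball (0:ℂ) 1, V z ^ 2 - 4 * U z * W z = 1) ∧
      (∀ z ∈ ball (0:ℂ) 1, ∀ᶠ w in 𝓝[≠] z, a w * (2 * U w) = V w + 1 ∧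
        a w * (V w - 1) = 2 * W w) := by
  have hev : ∀ z ∈ ball (0:ℂ) 1, ∀ᶠ w in 𝓝[≠] z, a w - b w ≠ 0 ∧
      δ * Real.sqrt ((1 + ‖a w‖ ^ 2) * (1 + ‖b w‖ ^ 2)) ≤ ‖a w - b w‖ := by
    intro z hz
    have hin : ∀ᶠ w in 𝓝[≠] z, w ∈ ball (0:ℂ) 1 :=
      eventually_nhdsWithin_of_eventually_nhds (isOpen_ball.mem_nhds hz)
    filter_upwards [(ha z hz).eventually_analyticAt, (hb z hz).eventually_analyticAt, hin]
      with w h1 h2 h3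
    have h4 := hsep w h3
    rw [sphVal_analytic h1, sphVal_analytic h2] at h4
    change δ ≤ 2 * ‖a w - b w‖ / Real.sqrt ((1 + ‖a w‖ ^ 2) * (1 + ‖b w‖ ^ 2)) / 2 at h4
    have hs : 0 < Real.sqrt ((1 + ‖a w‖ ^ 2) * (1 + ‖b w‖ ^ 2)) := by positivity
    have h5 : δ * Real.sqrt ((1 + ‖a w‖ ^ 2) * (1 + ‖b w‖ ^ 2)) ≤ ‖a w - b w‖ := by
      rw [← le_div_iff₀ hs]
      calc δ ≤ _ := h4
        _ = _ := by ring
    refine ⟨?_, h5⟩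
    rw [← norm_pos_iff]
    exact lt_of_lt_of_le (by positivity) h5
  have bound : ∀ x y : ℂ, ∀ t : ℝ, ∀ n : ℂ, x - y ≠ 0 →
      δ * Real.sqrt ((1 + ‖x‖ ^ 2) * (1 + ‖y‖ ^ 2)) ≤ ‖x - y‖ →
      ‖n‖ ^ 2 ≤ (1 + ‖x‖ ^ 2) * (1 + ‖y‖ ^ 2) → ‖n / (x - y)‖ ≤ 1 / δ := by
    intro x y t n h0 h1 h2
    rw [norm_div, div_le_div_iff₀ (norm_pos_iff.2 h0) hδ, one_mul]
    refine le_trans ?_ h1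
    rw [mul_comm]
    gcongr
    exact Real.le_sqrt_of_sq_le h2
  obtain ⟨U, dU, bU, eU⟩ := remove_sing (u := fun w => 1 / (a w - b w)) (C := 1 / δ)
    (fun z hz => by
      have := ha z hz
      have := hb z hz
      fun_prop)
    (fun z hz => by
      filter_upwards [hev z hz] with w hw
      refine bound _ _ 0 _ hw.1 hw.2 ?_
      simp only [norm_one]
      nlinarith [sq_nonneg ‖a w‖, sq_nonneg ‖b w‖, mul_nonneg (sq_nonneg ‖a w‖) (sq_nonneg ‖b w‖)])
  obtain ⟨V, dV, bV, eV⟩ := remove_sing (u := fun w => (a w + b w) / (a w - b w)) (C := 1 / δ)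
    (fun z hz => by
      have := ha z hz
      have := hb z hz
      fun_prop)
    (fun z hz => by
      filter_upwards [hev z hz] with w hw
      refine bound _ _ 0 _ hw.1 hw.2 ?_
      have : ‖a w + b w‖ ^ 2 ≤ (‖a w‖ + ‖b w‖) ^ 2 := by
        gcongr
        exact norm_add_le _ _
      nlinarith [sq_nonneg (‖a w‖ * ‖b w‖ - 1)])
  obtain ⟨W, dW, bW, eW⟩ := remove_sing (u := fun w => (a w * b w) / (a w - b w)) (C := 1 / δ)
    (fun z hz => by
      have := ha z hz
      have := hb z hz
      fun_prop)
    (fun z hz => by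
      filter_upwards [hev z hz] with w hw
      refine bound _ _ 0 _ hw.1 hw.2 ?_
      rw [norm_mul]
      nlinarith [sq_nonneg ‖a w‖, sq_nonneg ‖b w‖])
  refine ⟨U, V, W, ⟨dU, dV, dW⟩, fun z hz => ⟨bU z hz, bV z hz, bW z hz⟩, fun z hz => ?_,
    fun z hz => ?_⟩
  · have cU := (dU.differentiableAt (isOpen_ball.mem_nhds hz)).continuousAt
    have cV := (dV.differentiableAt (isOpen_ball.mem_nhds hz)).continuousAt
    have cW := (dW.differentiableAt (isOpen_ball.mem_nhds hz)).continuousAt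
    have c : ContinuousAt (fun z => V z ^ 2 - 4 * U z * W z) z := by fun_prop
    have t1 : Tendsto (fun z => V z ^ 2 - 4 * U z * W z) (𝓝[≠] z)
      (𝓝 (V z ^ 2 - 4 * U z * W z)) := c.tendsto.mono_left nhdsWithin_le_nhds
    refine tendsto_nhds_unique (t1.congr' ?_) tendsto_const_nhds
    filter_upwards [hev z hz, eU z hz, eV z hz, eW z hz] with w h1 h2 h3 h4
    rw [h2, h3, h4]
    have := h1.1
    field_simp
    ring
  · filter_upwards [hev z hz, eU z hz, eV z hz, eW z hz] with w h1 h2 h3 h4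
    rw [h2, h3, h4]
    have := h1.1
    constructor
    · field_simp
      ring
    · field_simp
      ring

theorem limit_fun {U V W : ℂ → ℂ} (dU : DifferentiableOn ℂ U (ball 0 1))
    (dV : DifferentiableOn ℂ V (ball 0 1)) (dW : DifferentiableOn ℂ W (ball 0 1))
    (hrel : ∀ z ∈ ball (0:ℂ) 1, V z ^ 2 - 4 * U z * W z = 1) :
    ∃ G : ℂ → OnePoint ℂ, IsMeroSphereOrInf (ball 0 1) G ∧
      ∀ z ∈ ball (0:ℂ) 1, (V z + 1 ≠ 0 → G z = hpt (V z + 1) (2 * U z)) ∧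
        (V z - 1 ≠ 0 → G z = hpt (2 * W z) (V z - 1)) := by
  have aU := dU.analyticOnNhd isOpen_ball
  have aV := dV.analyticOnNhd isOpen_ball
  have aW := dW.analyticOnNhd isOpen_ball
  have hpc : IsPreconnected (ball (0:ℂ) 1) := (convex_ball _ _).isPreconnected
  have hin : ∀ z ∈ ball (0:ℂ) 1, ∀ᶠ w in 𝓝[≠] z, w ∈ ball (0:ℂ) 1 := fun z hz =>
      eventually_nhdsWithin_of_eventually_nhds (isOpen_ball.mem_nhds hz)
  have fin : ∀ a : ℂ → ℂ, MeromorphicOn a (ball 0 1) →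
      (∀ z ∈ ball (0:ℂ) 1, ∀ᶠ w in 𝓝[≠] z, a w * (2 * U w) = V w + 1 ∧
        a w * (V w - 1) = 2 * W w) →
      ∃ G : ℂ → OnePoint ℂ, IsMeroSphereOrInf (ball 0 1) G ∧
      ∀ z ∈ ball (0:ℂ) 1, (V z + 1 ≠ 0 → G z = hpt (V z + 1) (2 * U z)) ∧
        (V z - 1 ≠ 0 → G z = hpt (2 * W z) (V z - 1)) := by
    intro a ha h
    refine ⟨sphVal a, Or.inl ⟨a, ha, fun _ _ => rfl⟩, fun z hz => ?_⟩
    have cU := (aU z hz).continuousAt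
    have cV := (aV z hz).continuousAt
    have cW := (aW z hz).continuousAt
    constructor
    · intro h0
      exact sphVal_eq_hpt (p := fun z => V z + 1) (q := fun z => 2 * U z)
        ((h z hz).mono fun w hw => hw.1) (by fun_prop) (by fun_prop) (Or.inl h0)
    · intro h0
      exact sphVal_eq_hpt (p := fun z => 2 * W z) (q := fun z => V z - 1)
        ((h z hz).mono fun w hw => hw.2) (by fun_prop) (by fun_prop) (Or.inr h0)
  by_cases hU : ∀ z ∈ ball (0:ℂ) 1, U z = 0
  · have hprod : (∀ z ∈ ball (0:ℂ) 1, V z - 1 = 0) ∨ (∀ z ∈ ball (0:ℂ) 1, V z + 1 = 0) := by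
      by_contra hcon
      push Not at hcon
      obtain ⟨⟨z, hz, hz0⟩, ⟨y, hy, hy0⟩⟩ := hcon
      have cV := (aV z hz).continuousAt
      have e1 : ∀ᶠ w in 𝓝 z, V w - 1 ≠ 0 :=
        (show ContinuousAt (fun w => V w - 1) z by fun_prop).eventually_ne hz0
      have e2 : (fun w => V w + 1) =ᶠ[𝓝 z] 0 := by
        filter_upwards [e1, isOpen_ball.mem_nhds hz] with w h1 h2
        have h3 := hrel w h2
        rw [hU w h2] at h3
        have h4 : (V w - 1) * (V w + 1) = 0 := by linear_combination h3
        exact (mul_eq_zero.1 h4).resolve_left h1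
      have an : AnalyticOnNhd ℂ (fun w => V w + 1) (ball 0 1) := aV.add analyticOnNhd_const
      exact hy0 (an.eqOn_zero_of_preconnected_of_eventuallyEq_zero hpc hz e2 hy)
    rcases hprod with h | h
    · refine ⟨fun _ => ∞, Or.inr fun _ _ => rfl, fun z hz => ⟨fun _ => ?_, fun h0 => ?_⟩⟩
      · simp [hpt, hU z hz]
      · exact absurd (h z hz) h0
    · refine fin (fun z => - W z) (fun z hz => (aW z hz).neg.meromorphicAt) fun z hz => ?_
      filter_upwards [hin z hz] with w hw
      have := h w hw
      rw [hU w hw]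
      constructor
      · rw [this]; ring
      · linear_combination (-W w) * this
  · push Not at hU
    obtain ⟨y, hy, hy0⟩ := hU
    have hne : ∀ z ∈ ball (0:ℂ) 1, ∀ᶠ w in 𝓝[≠] z, U w ≠ 0 := by
      intro z hz
      by_contra hcon
      exact hy0 (aU.eqOn_zero_of_preconnected_of_frequently_eq_zero hpc hz
        ((not_eventually.1 hcon).mono fun w h => not_not.1 h) hy)
    refine fin (fun z => (V z + 1) / (2 * U z)) (fun z hz => ?_) fun z hz => ?_
    · have := (aU z hz).meromorphicAt
      have := (aV z hz).meromorphicAt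
      fun_prop
    · filter_upwards [hne z hz, hin z hz] with w h1 h2
      have := hrel w h2
      constructor
      · field_simp
      · field_simp
        linear_combination this

theorem chord_small {p q r s : ℂ} (h1 : 1 / 2 ≤ ‖p‖ ∨ 1 / 2 ≤ ‖q‖) (h2 : 1 ≤ ‖r‖ ∨ 1 ≤ ‖s‖) :
    0 ≤ chord (hpt p q) (hpt r s) ∧ chord (hpt p q) (hpt r s) ≤ 4 * ‖p * s - r * q‖ := by
  have n1 : p ≠ 0 ∨ q ≠ 0 := by
    rcases h1 with h | h
    · left; rintro rfl; norm_num at h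
    · right; rintro rfl; norm_num at h
  have n2 : r ≠ 0 ∨ s ≠ 0 := by
    rcases h2 with h | h
    · left; rintro rfl; norm_num at h
    · right; rintro rfl; norm_num at h
  rw [chord_hpt n1 n2]
  refine ⟨by positivity, ?_⟩
  have s1 : 1 / 2 ≤ Real.sqrt (‖p‖^2 + ‖q‖^2) := by
    apply Real.le_sqrt_of_sq_le
    rcases h1 with h | h <;> nlinarith [sq_nonneg ‖p‖, sq_nonneg ‖q‖]
  have s2 : 1 ≤ Real.sqrt (‖r‖^2 + ‖s‖^2) := by
    apply Real.le_sqrt_of_sq_le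
    rcases h2 with h | h <;> nlinarith [sq_nonneg ‖r‖, sq_nonneg ‖s‖]
  rw [div_le_iff₀ (by positivity)]
  have : 1 / 2 ≤ Real.sqrt (‖p‖^2 + ‖q‖^2) * Real.sqrt (‖r‖^2 + ‖s‖^2) := by nlinarith
  nlinarith [norm_nonneg (p * s - r * q)]

theorem cross_small {p q r s : ℂ} {η C : ℝ} (hr : ‖r‖ ≤ C) (hs : ‖s‖ ≤ C)
    (hp : ‖p - r‖ ≤ η) (hq : ‖q - s‖ ≤ η) : ‖p * s - r * q‖ ≤ 2 * C * η := by
  have e : p * s - r * q = (p - r) * s - r * (q - s) := by ring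
  have hη : 0 ≤ η := (norm_nonneg _).trans hp
  have hC : 0 ≤ C := (norm_nonneg _).trans hr
  rw [e]
  calc _ ≤ ‖p - r‖ * ‖s‖ + ‖r‖ * ‖q - s‖ := by
        rw [← norm_mul, ← norm_mul]; exact norm_sub_le _ _
    _ ≤ η * C + C * η := by gcongr
    _ = 2 * C * η := by ring

theorem main_seq {f g : ℕ → ℂ → ℂ} {δ : ℝ} (hδ : 0 < δ)
    (hf : ∀ n, MeromorphicOn (f n) (ball 0 1)) (hg : ∀ n, MeromorphicOn (g n) (ball 0 1))
    (hsep : ∀ n, ∀ z ∈ ball (0:ℂ) 1, δ ≤ chord (sphVal (f n) z) (sphVal (g n) z) / 2) :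
    ∃ φ : ℕ → ℕ, StrictMono φ ∧ ∃ G : ℂ → OnePoint ℂ,
      IsMeroSphereOrInf (ball (0:ℂ) 1) G ∧
      ∀ K : Set ℂ, K ⊆ ball (0:ℂ) 1 → IsCompact K → ∀ ε : ℝ, 0 < ε →
        ∀ᶠ n in atTop, ∀ z ∈ K, sph (sphVal (f (φ n)) z) (G z) < ε := by
  choose u v w hd hb hrel hrep using fun n => pair_data hδ (hf n) (hg n) (hsep n)
  obtain ⟨φ₁, m₁, U, dU, bU, tU⟩ := montel_disk (f := u) (fun n => (hd n).1)
    (fun n z hz => (hb n z hz).1)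
  obtain ⟨φ₂, m₂, V, dV, bV, tV⟩ := montel_disk (f := fun n => v (φ₁ n))
    (fun n => (hd (φ₁ n)).2.1) (fun n z hz => (hb (φ₁ n) z hz).2.1)
  obtain ⟨φ₃, m₃, W, dW, bW, tW⟩ := montel_disk (f := fun n => w (φ₁ (φ₂ n)))
    (fun n => (hd (φ₁ (φ₂ n))).2.2) (fun n z hz => (hb (φ₁ (φ₂ n)) z hz).2.2)
  have tV' : TendstoLocallyUniformlyOn (fun n => v (φ₁ (φ₂ (φ₃ n)))) V atTop (ball 0 1) :=
    fun s hs x hx => by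
      obtain ⟨t, ht, h⟩ := tV s hs x hx
      exact ⟨t, ht, m₃.tendsto_atTop.eventually h⟩
  have tU' : TendstoLocallyUniformlyOn (fun n => u (φ₁ (φ₂ (φ₃ n)))) U atTop (ball 0 1) :=
    fun s hs x hx => by
      obtain ⟨t, ht, h⟩ := tU s hs x hx
      exact ⟨t, ht, (m₂.comp m₃).tendsto_atTop.eventually h⟩
  have hR : ∀ z ∈ ball (0:ℂ) 1, V z ^ 2 - 4 * U z * W z = 1 := by
    intro z hz
    have t := ((tV'.tendsto_at hz).pow 2).sub
      (((tU'.tendsto_at hz).const_mul 4).mul (tW.tendsto_at hz))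
    refine tendsto_nhds_unique (t.congr fun n => ?_) tendsto_const_nhds
    exact hrel _ z hz
  obtain ⟨G, hG, hGrep⟩ := limit_fun dU dV dW hR
  refine ⟨fun n => φ₁ (φ₂ (φ₃ n)), m₁.comp (m₂.comp m₃), G, hG, ?_⟩
  intro K hK hKc ε hε
  obtain ⟨η, hη, hηε⟩ : ∃ η > 0, ∀ c : ℝ, 0 ≤ c → c < η → 2 * Real.arcsin (c / 2) < ε := by
    have hc : ContinuousAt (fun c : ℝ => 2 * Real.arcsin (c / 2)) 0 := by
      have := Real.continuous_arcsin
      fun_prop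
    obtain ⟨η, hη, h⟩ := Metric.eventually_nhds_iff.1
      (hc.eventually_lt_const (show 2 * Real.arcsin ((0:ℝ) / 2) < ε by simpa using hε))
    refine ⟨η, hη, fun c h0 h1 => h ?_⟩
    simpa [abs_of_nonneg h0] using h1
  set C : ℝ := 2 / δ + 1 with hCdef
  have hCpos : 0 < C := by positivity
  have hC2 : 2 * (1 / δ) ≤ C := by rw [hCdef]; ring_nf; linarith
  have hC1 : 1 / δ + 1 ≤ C := by
    have : 0 < 1 / δ := by positivity
    have e : 2 / δ = 2 * (1 / δ) := by ring
    rw [hCdef, e]; linarith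
  obtain ⟨θ, hθ, hθ1, hθ2⟩ : ∃ θ : ℝ, 0 < θ ∧ 2 * θ ≤ 1 / 2 ∧ 4 * (2 * C * (2 * θ)) < η := by
    refine ⟨min (1 / 4) (η / (32 * C)), by positivity, ?_, ?_⟩
    · linarith [min_le_left (1 / 4 : ℝ) (η / (32 * C))]
    · have h := min_le_right (1 / 4 : ℝ) (η / (32 * C))
      calc 4 * (2 * C * (2 * min (1 / 4) (η / (32 * C))))
          ≤ 4 * (2 * C * (2 * (η / (32 * C)))) := by gcongr
        _ = η / 2 := by field_simp; ring
        _ < η := by linarith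
  rw [tendstoLocallyUniformlyOn_iff_forall_isCompact isOpen_ball] at tU' tV' tW
  filter_upwards [Metric.tendstoUniformlyOn_iff.1 (tU' K hK hKc) θ hθ,
    Metric.tendstoUniformlyOn_iff.1 (tV' K hK hKc) θ hθ,
    Metric.tendstoUniformlyOn_iff.1 (tW K hK hKc) θ hθ] with n hu hv hw z hz
  have hzD := hK hz
  specialize hu z hz
  specialize hv z hz
  specialize hw z hz
  rw [dist_comm, dist_eq_norm] at hu hv hw
  have bUz := bU z hzD
  have bVz := bV z hzD
  have bWz := bW z hzD
  obtain ⟨G1, G2⟩ := hGrep z hzD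
  set N := φ₁ (φ₂ (φ₃ n)) with hN
  have cU := (((hd N).1.differentiableAt (isOpen_ball.mem_nhds hzD))).continuousAt
  have cV := (((hd N).2.1.differentiableAt (isOpen_ball.mem_nhds hzD))).continuousAt
  have cW := (((hd N).2.2.differentiableAt (isOpen_ball.mem_nhds hzD))).continuousAt
  have hcase : 1 ≤ ‖V z + 1‖ ∨ 1 ≤ ‖V z - 1‖ := by
    by_contra! h
    have h2 : ‖(V z + 1) - (V z - 1)‖ ≤ ‖V z + 1‖ + ‖V z - 1‖ := norm_sub_le _ _
    have e : (V z + 1) - (V z - 1) = 2 := by ring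
    rw [e, Complex.norm_two] at h2
    linarith [h.1, h.2]
  have n2 : ∀ x : ℂ, ‖2 * x‖ = 2 * ‖x‖ := fun x => by rw [norm_mul, Complex.norm_two]
  rcases hcase with h | h
  · have h0 : V z + 1 ≠ 0 := by rintro h0; rw [h0] at h; norm_num at h
    have d1 : ‖(v N z + 1) - (V z + 1)‖ ≤ 2 * θ := by
      rw [show (v N z + 1) - (V z + 1) = v N z - V z by ring]; linarith
    have d2 : ‖2 * u N z - 2 * U z‖ ≤ 2 * θ := by rw [← mul_sub, n2]; linarith
    have h1 : 1 / 2 ≤ ‖v N z + 1‖ := by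
      have := norm_sub_norm_le (V z + 1) (v N z + 1)
      rw [norm_sub_rev (V z + 1)] at this
      linarith
    have h10 : v N z + 1 ≠ 0 := by rintro h0; rw [h0] at h1; norm_num at h1
    have e1 : sphVal (f N) z = hpt (v N z + 1) (2 * u N z) :=
      sphVal_eq_hpt (p := fun z => v N z + 1) (q := fun z => 2 * u N z)
        ((hrep N z hzD).mono fun w hw => hw.1) (by fun_prop) (by fun_prop) (Or.inl h10)
    rw [e1, G1 h0, sph]
    obtain ⟨c0, c1⟩ := chord_small (q := 2 * u N z) (s := 2 * U z) (Or.inl h1) (Or.inl h)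
    refine hηε _ c0 (lt_of_le_of_lt c1 ?_)
    have := cross_small (C := C) (r := V z + 1) (s := 2 * U z)
      ((norm_add_le _ _).trans (by rw [norm_one]; linarith)) (by rw [n2]; linarith) d1 d2
    linarith
  · have h0 : V z - 1 ≠ 0 := by rintro h0; rw [h0] at h; norm_num at h
    have d1 : ‖(v N z - 1) - (V z - 1)‖ ≤ 2 * θ := by
      rw [show (v N z - 1) - (V z - 1) = v N z - V z by ring]; linarith
    have d2 : ‖2 * w N z - 2 * W z‖ ≤ 2 * θ := by rw [← mul_sub, n2]; linarith
    have h1 : 1 / 2 ≤ ‖v N z - 1‖ := by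
      have := norm_sub_norm_le (V z - 1) (v N z - 1)
      rw [norm_sub_rev (V z - 1)] at this
      linarith
    have h10 : v N z - 1 ≠ 0 := by rintro h0; rw [h0] at h1; norm_num at h1
    have e1 : sphVal (f N) z = hpt (2 * w N z) (v N z - 1) :=
      sphVal_eq_hpt (p := fun z => 2 * w N z) (q := fun z => v N z - 1)
        ((hrep N z hzD).mono fun w hw => hw.2) (by fun_prop) (by fun_prop) (Or.inr h10)
    rw [e1, G2 h0, sph]
    obtain ⟨c0, c1⟩ := chord_small (p := 2 * w N z) (r := 2 * W z) (Or.inr h1) (Or.inr h)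
    refine hηε _ c0 (lt_of_le_of_lt c1 ?_)
    have := cross_small (C := C) (r := 2 * W z) (s := V z - 1)
      (by rw [n2]; linarith) ((norm_sub_le _ _).trans (by rw [norm_one]; linarith)) d2 d1
    linarith

theorem chord_ge {x y : OnePoint ℂ} {ε : ℝ} (hε : 0 < ε) (h : ε ≤ sph x y) :
    Real.sin (ε / 2) ≤ chord x y / 2 ∧ 0 < Real.sin (ε / 2) := by
  rw [sph] at h
  have h1 := Real.arcsin_le_pi_div_two (chord x y / 2)
  have h2 : ε / 2 ≤ Real.arcsin (chord x y / 2) := by linarith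
  have hpos : 0 < Real.sin (ε / 2) :=
    Real.sin_pos_of_pos_of_lt_pi (by linarith) (by linarith [Real.pi_pos])
  refine ⟨?_, hpos⟩
  exact (Real.le_arcsin_iff_sin_le' ⟨by linarith [Real.pi_pos], by linarith⟩).1 h2

theorem normal_of_spherically_separated
    (G : Set ((ℂ → ℂ) × (ℂ → ℂ)))
    (hG : ∀ p ∈ G, MeromorphicOn p.1 (Metric.ball (0:ℂ) 1) ∧
                   MeromorphicOn p.2 (Metric.ball (0:ℂ) 1))
    (ε : ℝ) (hε : 0 < ε)
    (hsep : ∀ p ∈ G, ∀ z ∈ Metric.ball (0:ℂ) 1,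
        ε ≤ sph (sphVal p.1 z) (sphVal p.2 z)) :
    NormalOn (Metric.ball (0:ℂ) 1) (Prod.fst '' G) ∧
    NormalOn (Metric.ball (0:ℂ) 1) (Prod.snd '' G) := by 
  constructor
  · intro f hf
    choose p hp hpf using hf
    have hd := fun (n : ℕ) (z : ℂ) (hz : z ∈ Metric.ball (0:ℂ) 1) =>
      chord_ge hε (hsep (p n) (hp n) z hz)
    have h0 : (0:ℂ) ∈ Metric.ball (0:ℂ) 1 := by simp
    have hfe : f = fun n => (p n).1 := (funext hpf).symm
    rw [hfe]
    exact main_seq (f := fun n => (p n).1) (g := fun n => (p n).2) (hd 0 0 h0).2 (fun n => (hG _ (hp n)).1) (fun n => (hG _ (hp n)).2)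
      (fun n z hz => (hd n z hz).1)
  · intro f hf
    choose p hp hpf using hf
    have hd := fun (n : ℕ) (z : ℂ) (hz : z ∈ Metric.ball (0:ℂ) 1) =>
      chord_ge hε (hsep (p n) (hp n) z hz)
    have h0 : (0:ℂ) ∈ Metric.ball (0:ℂ) 1 := by simp
    have hfe : f = fun n => (p n).2 := (funext hpf).symm
    rw [hfe]
    exact main_seq (f := fun n => (p n).2) (g := fun n => (p n).1) (hd 0 0 h0).2 (fun n => (hG _ (hp n)).2) (fun n => (hG _ (hp n)).1)
      (fun n z hz => by rw [chord_comm']; exact (hd n z hz).1)
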